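/- Let V be a nonlocal vertex algebra, let (W, Y_W) be a V-module, and let u, v, u⁽¹⁾, v⁽¹⁾, …, u⁽ʳ⁾, v⁽ʳ⁾ ∈ V and f₁(x), …, f_r(x) ∈ ℂ((x)). If the 𝒮-skew symmetry Y(u,x)v = Σ_{i=1}^r f_i(−x) e^{x𝒟} Y(v⁽ⁱ⁾, −x) u⁽ⁱ⁾ holds, then there exists a nonnegative integer k such that (x₁−x₂)^k Y_W(u,x₁)Y_W(v,x₂) = (x₁−x₂)^k Σ_{i=1}^r f_i(x₂−x₁) Y_W(v⁽ⁱ⁾,x₂)Y_W(u⁽ⁱ⁾,x₁). If (W, Y_W) is faithful, the converse also holds. -/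

import Mathlib

noncomputable section

open Classical

namespace NVA

/-! ### The space ℰ(W) = Hom(W, W((x))), coefficient-indexed by modes:
`a w n` is the mode `a_n` applied to `w`, where `a(x)w = ∑ (a_n w) x^{-n-1}`.
Lower truncation of `a(x)w` in powers of `x` means `a_n w = 0` for `n` large. -/

variable (W : Type*) [AddCommGroup W] [Module ℂ W]

/-- `ℰ(W) = Hom(W, W((x)))` as a submodule of `Hom(W, W[[x^{±1}]])`. -/
def EWsub : Submodule ℂ (W →ₗ[ℂ] (ℤ → W)) where
  carrier := {a | ∀ w : W, ∃ N : ℤ, ∀ n : ℤ, N ≤ n → a w n = 0}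
  add_mem' := by
    intro a b ha hb w
    obtain ⟨N, hN⟩ := ha w
    obtain ⟨M, hM⟩ := hb w
    refine ⟨max N M, fun n hn => ?_⟩
    simp only [LinearMap.add_apply, Pi.add_apply,
      hN n (le_trans (le_max_left _ _) hn), hM n (le_trans (le_max_right _ _) hn), add_zero]
  zero_mem' := by intro w; exact ⟨0, fun n _ => rfl⟩
  smul_mem' := by
    intro c a ha w
    obtain ⟨N, hN⟩ := ha w
    exact ⟨N, fun n hn => by
      simp only [LinearMap.smul_apply, Pi.smul_apply, hN n hn, smul_zero]⟩

/-- The type `ℰ(W)`. -/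
abbrev EW := ↥(EWsub W)

variable {W}

/-- The mode function of an element of `ℰ(W)`. -/
def mf (a : EW W) : W → ℤ → W := fun w n => (a : W →ₗ[ℂ] (ℤ → W)) w n

/-- The identity operator `1_W`, as an element of `ℰ(W)`. -/
def oneE : EW W :=
  ⟨{ toFun := fun w n => if n = -1 then w else 0
     map_add' := by
       intro w w'; funext n; by_cases h : n = -1 <;> simp [h]
     map_smul' := by
       intro c w; funext n; by_cases h : n = -1 <;> simp [h] },
   fun w => ⟨0, fun n hn => if_neg (by omega)⟩⟩

/-- The generalized binomial coefficient `C(m, j)` for `m ∈ ℤ`, as a complex number. -/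
def binom (m : ℤ) (j : ℕ) : ℂ :=
  (∏ i ∈ Finset.range j, ((m : ℂ) - (i : ℂ))) / (j.factorial : ℂ)

/-- The coefficient of `x₁^m x₂^t` in `a(x₁) b(x₂) w`. -/
def Fab (a b : EW W) (w : W) (m t : ℤ) : W := mf a (mf b w (-t - 1)) (-m - 1)

/-- Multiplication of a two-variable family by a polynomial `p(x₁,x₂)`. -/
def mulPoly (p : MvPolynomial (Fin 2) ℂ) (F : ℤ → ℤ → W) : ℤ → ℤ → W :=
  fun m t => ∑ d ∈ p.support, MvPolynomial.coeff d p • F (m - d 0) (t - d 1)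

/-- A two-variable family lies in `W((x₁,x₂))` (jointly lower truncated). -/
def IsLaurent2 (F : ℤ → ℤ → W) : Prop :=
  ∃ N : ℤ, ∀ m t : ℤ, (m < N ∨ t < N) → F m t = 0

/-- Quasi compatibility of an ordered pair `(a(x), b(x))` in `ℰ(W)`:
`p(x₁,x₂) a(x₁) b(x₂) ∈ Hom(W, W((x₁,x₂)))` for some nonzero polynomial `p`. -/
def QCPair (a b : EW W) : Prop :=
  ∃ p : MvPolynomial (Fin 2) ℂ, p ≠ 0 ∧ ∀ w, IsLaurent2 (mulPoly p (Fab a b w))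

/-! ### Sequences -/

/-- The coefficient of `x₁^{k 1} ⋯ x_r^{k r}` in `ψ₁(x₁) ⋯ ψ_r(x_r) w`. -/
def seqCoeff : {r : ℕ} → (Fin r → EW W) → W → (Fin r → ℤ) → W
  | 0, _, w, _ => w
  | _ + 1, ψ, w, k => mf (ψ 0) (seqCoeff (Fin.tail ψ) w (Fin.tail k)) (-(k 0) - 1)

/-- The polynomial `∏_{1 ≤ i < j ≤ r} p(x_i, x_j)`. -/
def pairPoly (p : MvPolynomial (Fin 2) ℂ) (r : ℕ) : MvPolynomial (Fin r) ℂ :=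
  ∏ ij ∈ Finset.univ.filter (fun ij : Fin r × Fin r => ij.1 < ij.2),
    MvPolynomial.rename ![ij.1, ij.2] p

/-- Multiplication of an `r`-variable family by a polynomial in `r` variables. -/
def mulPolyN {r : ℕ} (P : MvPolynomial (Fin r) ℂ) (F : (Fin r → ℤ) → W) :
    (Fin r → ℤ) → W :=
  fun k => ∑ d ∈ P.support, MvPolynomial.coeff d P • F (fun i => k i - d i)

/-- An `r`-variable family lies in `W((x₁,…,x_r))`. -/
def IsLaurentN {r : ℕ} (F : (Fin r → ℤ) → W) : Prop :=
  ∃ N : ℤ, ∀ k : Fin r → ℤ, (∃ i, k i < N) → F k = 0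

/-- Quasi compatibility of an ordered sequence in `ℰ(W)`. -/
def QCSeq {r : ℕ} (ψ : Fin r → EW W) : Prop :=
  ∃ p : MvPolynomial (Fin 2) ℂ, p ≠ 0 ∧
    ∀ w, IsLaurentN (mulPolyN (pairPoly p r) (seqCoeff ψ w))

/-- Quasi compatibility of a subset of `ℰ(W)`. -/
def QCSet (S : Set (EW W)) : Prop :=
  ∀ (r : ℕ) (ψ : Fin r → EW W), (∀ i, ψ i ∈ S) → QCSeq ψ

/-! ### The vertex operation `Y_ℰ^{(α)}` -/

/-- `ℂ((x))`. -/
abbrev LC : Type := LaurentSeries ℂ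

/-- An iterated Laurent series field, e.g. `ℂ((x))((x₀))` (outer variable the second one). -/
abbrev K2 : Type := HahnSeries ℤ LC

/-- The outer variable of `K2`. -/
def xOuter : K2 := HahnSeries.single 1 1

/-- The inner variable of `K2`. -/
def xInner : K2 := HahnSeries.single 0 (HahnSeries.single 1 1)

/-- `α` times the inner variable of `K2`. -/
def xInnerC (c : ℂ) : K2 := HahnSeries.single 0 (HahnSeries.single 1 c)

/-- The polynomial `p(x₀ + α x, x)` as an element of `ℂ((x))((x₀))`
(outer variable `x₀`). -/
def qK (p : MvPolynomial (Fin 2) ℂ) (α : ℂ) : K2 :=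
  MvPolynomial.aeval ![xOuter + xInnerC α, xInner] p

/-- The expansion `ι_{x,x₀} (p(x₀ + α x, x)^{-1}) ∈ ℂ((x))((x₀))`. -/
def qInv (p : MvPolynomial (Fin 2) ℂ) (α : ℂ) : K2 := (qK p α)⁻¹

/-- The coefficient of `x₀^j x^t` in `(p(x₁,x) a(x₁) b(x) w)|_{x₁ = αx + x₀}`,
expanding via `(αx+x₀)^m = ∑_{j≥0} C(m,j) α^{m-j} x^{m-j} x₀^j`. -/
def substYE (α : ℂ) (p : MvPolynomial (Fin 2) ℂ) (a b : EW W) (w : W)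
    (j : ℕ) (t : ℤ) : W :=
  ∑ᶠ m : ℤ, (binom m j * α ^ (m - (j : ℤ))) • mulPoly p (Fab a b w) m (t - m + j)

/-- The coefficient of `x₀^J x^T` in
`ι_{x,x₀}(p(x₀+αx,x)^{-1}) ⬝ (p(x₁,x)a(x₁)b(x)w)|_{x₁ = αx+x₀}`. -/
def fullYE (α : ℂ) (p : MvPolynomial (Fin 2) ℂ) (a b : EW W) (w : W)
    (J T : ℤ) : W :=
  ∑ᶠ s : ℤ × ℤ, (((qInv p α).coeff s.1).coeff s.2) •
    (if 0 ≤ J - s.1 then substYE α p a b w (J - s.1).toNat (T - s.2) else 0)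

/-- The raw mode family of `Y_ℰ^{(α)}(a(x), x₀) b(x)`; `rawYE α a b n w m` is the mode
`m` of the element `a(x)_{(α,n)} b(x)` applied to `w`.  (Defined using a choice of
polynomial from quasi compatibility; by the general theory the value does not depend
on the choice.) -/
def rawYE (α : ℂ) (a b : EW W) (n : ℤ) (w : W) (m : ℤ) : W :=
  if h : QCPair a b then fullYE α h.choose a b w (-n - 1) (-m - 1) else 0

/-- `a(x)_{(α,n)} b(x)`, as an element of `ℰ(W)` whenever the raw family is realized
by one (which is the case for any quasi compatible pair). -/
def YEa (α : ℂˣ) (a b : EW W) (n : ℤ) : EW W :=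
  if h : ∃ c : EW W, ∀ w m, mf c w m = rawYE (α : ℂ) a b n w m then h.choose else 0

/-- `a(x)_n b(x) = a(x)_{(1,n)} b(x)`. -/
def YE (a b : EW W) (n : ℤ) : EW W := YEa 1 a b n

end NVA

namespace NVA

variable {W : Type*} [AddCommGroup W] [Module ℂ W]

/-- Submodules of `ℰ(W)` are `ℂ`-vector spaces (registered explicitly to assist
instance resolution). -/
noncomputable instance (V : Submodule ℂ (EW W)) : AddCommGroup ↥V :=
  @Submodule.addCommGroup ℂ (EW W) _ inferInstance inferInstance V

noncomputable instance (V : Submodule ℂ (EW W)) : Module ℂ ↥V :=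
  @Submodule.module ℂ (EW W) _ inferInstance inferInstance V

/-! ### Derivative and scaling operators on ℰ(W) -/

/-- `D = d/dx` on `ℰ(W)`: `(Da)_m = -m • a_{m-1}`. -/
def Dop (a : EW W) : EW W :=
  ⟨{ toFun := fun w m => (-m : ℂ) • mf a w (m - 1)
     map_add' := by intro w w'; funext m; simp [mf, map_add]
     map_smul' := by
       intro c w; funext m
       simp only [mf, map_smul, Pi.smul_apply, RingHom.id_apply]
       exact smul_comm _ _ _ },
   by
     intro w
     obtain ⟨N, hN⟩ := a.2 w
     exact ⟨N + 1, fun m hm => by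
       have : (a : W →ₗ[ℂ] (ℤ → W)) w (m - 1) = 0 := hN _ (by omega)
       simp [mf, this]⟩⟩

/-- `R_α : a(x) ↦ a(αx)`, on modes `(R_α a)_m = α^{-m-1} a_m`. -/
def RaE (α : ℂˣ) (a : EW W) : EW W :=
  ⟨{ toFun := fun w m => ((α : ℂ) ^ (-m - 1 : ℤ)) • mf a w m
     map_add' := by intro w w'; funext m; simp [mf, map_add]
     map_smul' := by
       intro c w; funext m
       simp only [mf, map_smul, Pi.smul_apply, RingHom.id_apply]
       exact smul_comm _ _ _ },
   by
     intro w
     obtain ⟨N, hN⟩ := a.2 w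
     exact ⟨N, fun m hm => by simp [mf, hN m hm]⟩⟩

/-! ### Nonlocal vertex algebras, modules and quasi modules -/

/-- The coefficient of `x₀^a x₂^b` in `Y₁(u, x₀+x₂) (Y₂(v,x₂) w)`, where
`(x₀+x₂)^m` is expanded in nonnegative powers of `x₂`. -/
def prodCE {V : Type*} (Yo Yi : V → W → ℤ → W) (u v : V) (w : W) (a b : ℤ) : W :=
  ∑ᶠ m : ℤ, if a ≤ m then
    binom m (m - a).toNat • Yo u (Yi v w (-(b - (m - a)) - 1)) (-m - 1) else 0

/-- The coefficient of `x₀^a x₂^b` in `Y₂(Y₁(u,x₀)v, x₂) w`. -/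
def assocCE {V : Type*} (Y1 : V → V → ℤ → V) (Y2 : V → W → ℤ → W)
    (u v : V) (w : W) (a b : ℤ) : W :=
  Y2 (Y1 u v (-a - 1)) w (-b - 1)

/-- Multiplication of a two-variable family (in `x₀, x₂`) by `f(x₀+x₂, x₂)` for a
polynomial `f`, expanding `(x₀+x₂)^d` in nonnegative powers of `x₂`. -/
def mulSubPoly (f : MvPolynomial (Fin 2) ℂ) (A : ℤ → ℤ → W) (a b : ℤ) : W :=
  ∑ d ∈ f.support, ∑ i ∈ Finset.range (d 0 + 1),
    (MvPolynomial.coeff d f * ((d 0).choose i : ℂ)) •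
      A (a - ((d 0 : ℤ) - i)) (b - i - (d 1 : ℤ))

/-- A nonlocal vertex algebra structure on a ℂ-vector space `V`:
a linear map `Y : V → ℰ(V) = Hom(V, V((x)))` and a vacuum vector `1` such that
`Y(1,x)v = v`, `Y(v,x)1 ∈ V[[x]]` with constant term `v`, and weak associativity
holds. -/
structure NLVA (V : Type*) [AddCommGroup V] [Module ℂ V] where
  Y : V →ₗ[ℂ] EW V
  one : V
  vac : ∀ (v : V) (n : ℤ), mf (Y one) v n = if n = -1 then v else 0
  creation0 : ∀ (v : V) (n : ℤ), 0 ≤ n → mf (Y v) one n = 0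
  creation1 : ∀ v : V, mf (Y v) one (-1) = v
  wassoc : ∀ u v w : V, ∃ l : ℕ, ∀ a b : ℤ,
    mulSubPoly (MvPolynomial.X 0 ^ l)
      (prodCE (fun x => mf (Y x)) (fun x => mf (Y x)) u v w) a b =
    mulSubPoly (MvPolynomial.X 0 ^ l)
      (assocCE (fun x y n => mf (Y x) y n) (fun x => mf (Y x)) u v w) a b

/-- The mode maps of a nonlocal vertex algebra: `Yf A u v n = u_n v`. -/
def Yf {V : Type*} [AddCommGroup V] [Module ℂ V] (A : NLVA V) : V → V → ℤ → V :=
  fun u v n => mf (A.Y u) v n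

/-- Mode maps of a linear map `V → ℰ(W)`. -/
def YWf {V : Type*} [AddCommGroup V] [Module ℂ V] (YW : V →ₗ[ℂ] EW W) :
    V → W → ℤ → W := fun v w n => mf (YW v) w n

/-- `(W, Y_W)` is a quasi module for the nonlocal vertex algebra `A` on `V`. -/
def IsQuasiModule {V : Type*} [AddCommGroup V] [Module ℂ V] (A : NLVA V)
    (YW : V →ₗ[ℂ] EW W) : Prop :=
  (∀ (w : W) (n : ℤ), mf (YW A.one) w n = if n = -1 then w else 0) ∧
  ∀ (u v : V) (w : W), ∃ f : MvPolynomial (Fin 2) ℂ, f ≠ 0 ∧ ∀ a b : ℤ,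
    mulSubPoly f (prodCE (YWf YW) (YWf YW) u v w) a b =
    mulSubPoly f (assocCE (Yf A) (YWf YW) u v w) a b

/-- `(W, Y_W)` is a module for the nonlocal vertex algebra `A` on `V`. -/
def IsModule {V : Type*} [AddCommGroup V] [Module ℂ V] (A : NLVA V)
    (YW : V →ₗ[ℂ] EW W) : Prop :=
  (∀ (w : W) (n : ℤ), mf (YW A.one) w n = if n = -1 then w else 0) ∧
  ∀ (u v : V) (w : W), ∃ l : ℕ, ∀ a b : ℤ,
    mulSubPoly (MvPolynomial.X 0 ^ l) (prodCE (YWf YW) (YWf YW) u v w) a b =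
    mulSubPoly (MvPolynomial.X 0 ^ l) (assocCE (Yf A) (YWf YW) u v w) a b

end NVA

namespace NVA

variable {W : Type*} [AddCommGroup W] [Module ℂ W]
variable {V : Type*} [AddCommGroup V] [Module ℂ V]

/-! ### Pseudo-locality -/

/-- A power series `∑ f n x^n` as a Laurent series. -/
def psN (f : ℕ → ℂ) : LC := HahnSeries.ofPowerSeries ℤ ℂ (PowerSeries.mk f)

/-- `ι_{x₂,x₁}` of a formal power series `F(x₁,x₂) ∈ ℂ[[x₁,x₂]]`, given by its
coefficient function, as an element of `ℂ((x₂))((x₁))` (outer variable `x₁`). -/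
def psEmbed (F : ℕ → ℕ → ℂ) : K2 :=
  HahnSeries.ofPowerSeries ℤ LC (PowerSeries.mk (fun m => psN (F m)))

/-- The coefficient function of a polynomial in two variables. -/
def polyCoeffFun (g : MvPolynomial (Fin 2) ℂ) : ℕ → ℕ → ℂ :=
  fun m t => MvPolynomial.coeff (Finsupp.single 0 m + Finsupp.single 1 t) g

/-- `ι_{x₂,x₁}` of a polynomial in two variables. -/
def polyEmbed (g : MvPolynomial (Fin 2) ℂ) : K2 := psEmbed (polyCoeffFun g)

/-- The coefficient function of an element of `ℂ((x₂))((x₁))`: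
`k2Fun x m t` is the coefficient of `x₁^m x₂^t`. -/
def k2Fun (x : K2) : ℤ → ℤ → ℂ := fun m t => (x.coeff m).coeff t

/-- Multiplication of a two-variable family by a scalar-valued two-variable series. -/
def smulFam (c : ℤ → ℤ → ℂ) (G : ℤ → ℤ → W) : ℤ → ℤ → W :=
  fun m t => ∑ᶠ s : ℤ × ℤ, c s.1 s.2 • G (m - s.1) (t - s.2)

/-- Multiplication of a two-variable family by a Laurent polynomial
`p ∈ ℂ[x₁^{±1}, x₂^{±1}]` (recorded by its finitely supported coefficients). -/
def mulLPoly (p : (ℤ × ℤ) →₀ ℂ) (G : ℤ → ℤ → W) : ℤ → ℤ → W :=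
  fun m t => ∑ d ∈ p.support, p d • G (m - d.1) (t - d.2)

/-- A subset `S ⊆ ℰ(W)` is pseudo-local. -/
def PseudoLocal (S : Set (EW W)) : Prop :=
  ∀ a ∈ S, ∀ b ∈ S, ∃ p : (ℤ × ℤ) →₀ ℂ, p ≠ 0 ∧
    ∃ (r : ℕ) (F : Fin r → (ℕ → ℕ → ℂ)) (g : Fin r → MvPolynomial (Fin 2) ℂ)
      (u v : Fin r → EW W),
      (∀ i, g i ≠ 0) ∧ (∀ i, u i ∈ S) ∧ (∀ i, v i ∈ S) ∧
      ∀ (w : W) (m t : ℤ),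
        mulLPoly p (Fab a b w) m t =
          ∑ i, smulFam (k2Fun (psEmbed (F i) * (polyEmbed (g i))⁻¹))
            (fun m' t' => Fab (u i) (v i) w t' m') m t

/-- The coefficient of `x₁^m x₂^t` in `ι_{x₂,x₁} f(x₂ - x₁)`, for `f(x) ∈ ℂ((x))`. -/
def expandSub (f : LC) : ℤ → ℤ → ℂ :=
  fun m t => if 0 ≤ m then
    ((-1 : ℂ) ^ m.toNat * binom (t + m) m.toNat) * f.coeff (t + m) else 0

/-- A subset `S ⊆ ℰ(W)` is `𝒮`-local. -/
def SLocal (S : Set (EW W)) : Prop :=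
  ∀ a ∈ S, ∀ b ∈ S, ∃ (k : ℕ) (r : ℕ) (f : Fin r → LC) (u v : Fin r → EW W),
    (∀ i, u i ∈ S) ∧ (∀ i, v i ∈ S) ∧
    ∀ (w : W) (m t : ℤ),
      mulPoly ((MvPolynomial.X 0 - MvPolynomial.X 1) ^ k) (Fab a b w) m t =
        ∑ i, mulPoly ((MvPolynomial.X 0 - MvPolynomial.X 1) ^ k)
          (smulFam (expandSub (f i)) (fun m' t' => Fab (u i) (v i) w t' m')) m t

/-- `U` is the nonlocal vertex algebra `⟨S⟩` generated by `S`: the smallest closed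
quasi compatible subspace of `ℰ(W)` containing `S ∪ {1_W}`. -/
def IsGenVA (S : Set (EW W)) (U : Submodule ℂ (EW W)) : Prop :=
  QCSet (U : Set (EW W)) ∧ (∀ a ∈ U, ∀ b ∈ U, ∀ n : ℤ, YE a b n ∈ U) ∧
  oneE ∈ U ∧ S ⊆ U ∧
  ∀ U' : Submodule ℂ (EW W),
    (QCSet (U' : Set (EW W)) ∧ (∀ a ∈ U', ∀ b ∈ U', ∀ n : ℤ, YE a b n ∈ U') ∧
      oneE ∈ U' ∧ S ⊆ (U' : Set (EW W))) → U ≤ U'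

/-! ### 𝒮-locality for maps and weak quantum vertex algebras -/

/-- The `𝒮`-locality identity
`(x₁-x₂)^k Y(u,x₁)Y(v,x₂) = ∑ᵢ (x₁-x₂)^k ι_{x₂,x₁}(fᵢ(x₂-x₁)) Y(vᵢ,x₂)Y(uᵢ,x₁)`
at the level of coefficient families, for mode maps `Ym`. -/
def sLocPair {V : Type*} (Ym : V → W → ℤ → W) (k : ℕ) (u v : V) {r : ℕ}
    (f : Fin r → LC) (vi ui : Fin r → V) : Prop :=
  ∀ (w : W) (m t : ℤ),
    mulPoly ((MvPolynomial.X 0 - MvPolynomial.X 1) ^ k)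
      (fun m' t' => Ym u (Ym v w (-t' - 1)) (-m' - 1)) m t =
    ∑ i, mulPoly ((MvPolynomial.X 0 - MvPolynomial.X 1) ^ k)
      (smulFam (expandSub (f i))
        (fun m' t' => Ym (vi i) (Ym (ui i) w (-m' - 1)) (-t' - 1))) m t

/-- A weak quantum vertex algebra: a nonlocal vertex algebra whose vertex operators
form an `𝒮`-local subspace of `ℰ(V)`. -/
def IsWeakQVA (A : NLVA V) : Prop :=
  ∀ u v : V, ∃ (k : ℕ) (r : ℕ) (f : Fin r → LC) (vi ui : Fin r → V),
    sLocPair (Yf A) k u v f vi ui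

end NVA

namespace NVA

variable {V : Type*} [AddCommGroup V] [Module ℂ V]

/-- The operator `𝒟` of a nonlocal vertex algebra: `𝒟 v = v₋₂ 1`. -/
def Dmap (A : NLVA V) : V → V := fun v => Yf A v A.one (-2)

/-- The coefficient of `x^j` in `e^{x𝒟} Y(v, -x) u`. -/
def expDY (A : NLVA V) (v u : V) (j : ℤ) : V :=
  ∑ᶠ q : ℤ, if q ≤ j then
    ((((j - q).toNat.factorial : ℂ))⁻¹ * (-1 : ℂ) ^ q) •
      (Dmap A)^[(j - q).toNat] (Yf A v u (-q - 1))
  else 0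

section Expansion

variable {M : Type*} [AddCommGroup M] [Module ℂ M]

/-! ### Formal series in one variable -/

/-- Multiplication by the variable on `M[[z^{±1}]]`. -/
def shift : Module.End ℂ (ℤ → M) := LinearMap.funLeft ℂ M (fun m : ℤ => m - 1)

/-- Multiplication by `z - 1` on `M[[z^{±1}]]`. -/
def delta : Module.End ℂ (ℤ → M) := shift - 1

@[simp] lemma shift_apply (F : ℤ → M) (m : ℤ) : shift F m = F (m - 1) := rfl

@[simp] lemma delta_apply (F : ℤ → M) (m : ℤ) : delta F m = F (m - 1) - F m := rfl

lemma delta_eq_sub (F : ℤ → M) : delta F = shift F - F := rfl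

lemma shift_add_one_apply (F : ℤ → M) (m : ℤ) :
    (shift + 1 : Module.End ℂ (ℤ → M)) F m = F (m - 1) + F m := rfl

lemma shift_pow_apply (k : ℕ) (F : ℤ → M) (m : ℤ) : (shift ^ k) F m = F (m - k) := by
  induction k generalizing m with
  | zero => simp
  | succ k ih =>
    rw [pow_succ', Module.End.mul_apply, shift_apply, ih]
    congr 1; push_cast; ring

lemma shift_pow_injective (k : ℕ) :
    Function.Injective ((shift : Module.End ℂ (ℤ → M)) ^ k) := by
  intro F G h
  funext m
  have := congrFun h (m + k)
  simpa [shift_pow_apply] using this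

lemma shift_add_one_pow_apply (l : ℕ) (F : ℤ → M) (a : ℤ) :
    ((shift + 1 : Module.End ℂ (ℤ → M)) ^ l) F a =
      ∑ i ∈ Finset.range (l + 1), (l.choose i : ℂ) • F (a - ((l : ℤ) - i)) := by
  rw [add_comm, (Commute.one_left (shift : Module.End ℂ (ℤ → M))).add_pow]
  simp only [one_pow, one_mul, LinearMap.sum_apply, Finset.sum_apply]
  refine Finset.sum_congr rfl fun i hi => ?_
  have hi' : i ≤ l := Nat.lt_succ_iff.1 (Finset.mem_range.1 hi)
  rw [Module.End.mul_apply, shift_pow_apply, Module.End.natCast_apply, Pi.smul_apply,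
    Nat.cast_sub hi', Nat.cast_smul_eq_nsmul]

lemma eq_zero_of_shift_add_one_pow {l : ℕ} {F : ℤ → M} {N : ℤ} (hN : ∀ m < N, F m = 0)
    (h : ((shift + 1 : Module.End ℂ (ℤ → M)) ^ l) F = 0) : F = 0 := by
  induction l generalizing F with
  | zero => simpa using h
  | succ l ih =>
    rw [pow_succ, Module.End.mul_apply] at h
    have h1 : (shift + 1 : Module.End ℂ (ℤ → M)) F = 0 :=
      ih (fun m hm => by simp [shift_add_one_apply, hN m hm, hN (m - 1) (by omega)]) h
    funext m
    rcases lt_or_ge m N with hm | hm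
    · exact hN m hm
    induction m, hm using Int.leInduction with
    | base =>
      have := congrFun h1 N
      simpa [shift_add_one_apply, hN (N - 1) (by omega)] using this
    | succ n hn ihn =>
      have := congrFun h1 (n + 1)
      simpa [shift_add_one_apply, ihn] using this

/-! ### Binomial coefficients -/

lemma binom_zero_right (m : ℤ) : binom m 0 = 1 := by simp [binom]

lemma binom_succ_right (m : ℤ) (j : ℕ) :
    binom m (j + 1) = binom m j * (m - j) / (j + 1) := by
  have : (j.factorial : ℂ) ≠ 0 := by exact_mod_cast j.factorial_ne_zero
  have h2 : (j + 1 : ℂ) ≠ 0 := by exact_mod_cast j.succ_ne_zero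
  simp only [binom, Finset.prod_range_succ, Nat.factorial_succ]
  push_cast
  field_simp

lemma binom_succ_succ_mul (m : ℤ) (j : ℕ) :
    binom (m + 1) (j + 1) = binom m j * (m + 1) / (j + 1) := by
  have : (j.factorial : ℂ) ≠ 0 := by exact_mod_cast j.factorial_ne_zero
  have h2 : (j + 1 : ℂ) ≠ 0 := by exact_mod_cast j.succ_ne_zero
  simp only [binom, Finset.prod_range_succ', Nat.factorial_succ]
  push_cast
  simp only [add_sub_add_right_eq_sub, sub_zero]
  field_simp

lemma binom_succ_succ (m : ℤ) (j : ℕ) :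
    binom (m + 1) (j + 1) = binom m (j + 1) + binom m j := by
  have h2 : (j + 1 : ℂ) ≠ 0 := by exact_mod_cast j.succ_ne_zero
  rw [binom_succ_succ_mul, binom_succ_right]
  field_simp
  ring

lemma binom_natCast (n j : ℕ) : binom n j = n.choose j := by
  induction n generalizing j with
  | zero => cases j <;> simp [binom, Finset.prod_range_succ']
  | succ n ih =>
    cases j with
    | zero => simp [binom]
    | succ j =>
      rw [Nat.cast_succ, binom_succ_succ, ih, ih, Nat.choose_succ_succ, add_comm]
      push_cast; rfl

/-- The binomial coefficient `C(m, a)`, extended by zero to negative `a`. -/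
def ibinom (m a : ℤ) : ℂ := if 0 ≤ a then binom m a.toNat else 0

lemma ibinom_of_neg {m a : ℤ} (h : a < 0) : ibinom m a = 0 := if_neg (by omega)

@[simp] lemma ibinom_natCast (m : ℤ) (j : ℕ) : ibinom m j = binom m j := by
  simp [ibinom]

@[simp] lemma ibinom_zero_right (m : ℤ) : ibinom m 0 = 1 := by
  simp [ibinom, binom_zero_right]

lemma ibinom_succ (m a : ℤ) : ibinom (m + 1) a = ibinom m a + ibinom m (a - 1) := by
  rcases lt_trichotomy a 0 with h | rfl | h
  · simp [ibinom_of_neg h, ibinom_of_neg (show a - 1 < 0 by omega)]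
  · simp [ibinom_of_neg]
  · obtain ⟨j, rfl⟩ : ∃ j : ℕ, a = (j + 1 : ℕ) := ⟨(a - 1).toNat, by omega⟩
    rw [show ((j + 1 : ℕ) : ℤ) - 1 = (j : ℕ) by push_cast; ring]
    simp only [ibinom_natCast, binom_succ_succ]

lemma ibinom_zero_left {a : ℤ} (ha : a ≠ 0) : ibinom 0 a = 0 := by
  rcases lt_or_ge a 0 with h | h
  · exact ibinom_of_neg h
  · obtain ⟨j, rfl⟩ : ∃ j : ℕ, a = (j + 1 : ℕ) := ⟨(a - 1).toNat, by omega⟩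
    rw [ibinom_natCast]
    simpa using binom_natCast 0 (j + 1)

lemma ibinom_symm {m : ℤ} (hm : 0 ≤ m) (a : ℤ) : ibinom m (m - a) = ibinom m a := by
  lift m to ℕ using hm
  rcases lt_or_ge a 0 with h | h
  · obtain ⟨j, hj⟩ : ∃ j : ℕ, (m : ℤ) - a = j := ⟨(m - a).toNat, by omega⟩
    rw [hj, ibinom_natCast, binom_natCast, Nat.choose_eq_zero_of_lt (by omega), ibinom_of_neg h,
      Nat.cast_zero]
  lift a to ℕ using h
  rcases le_or_gt a m with h' | h'
  · rw [← Nat.cast_sub h', ibinom_natCast, ibinom_natCast, binom_natCast, binom_natCast,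
      Nat.choose_symm h']
  · rw [ibinom_of_neg (by omega), ibinom_natCast, binom_natCast, Nat.choose_eq_zero_of_lt h',
      Nat.cast_zero]

/-- The coefficient identity behind `(1+y)^{n-m} = ∑ₐ C(m,a) (-y)^a (1+y)^{n-a}`. -/
lemma ibinom_sub (j : ℕ) (n m : ℤ) :
    ibinom (n - m) j =
      ∑ a ∈ Finset.range (j + 1), (-1 : ℂ) ^ a * ibinom (n - a) (j - a) * ibinom m a := by
  induction j generalizing n m with
  | zero => simp [ibinom, binom_zero_right]
  | succ j ih =>
    set g : ℤ → ℂ := fun m =>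
      ∑ a ∈ Finset.range (j + 1 + 1),
        (-1 : ℂ) ^ a * ibinom (n - a) ((j + 1 : ℕ) - a) * ibinom m a with hg
    have hstep : ∀ m, g (m + 1) = g m - ibinom (n - 1 - m) j := by
      intro m
      rw [ih, hg]
      simp only [ibinom_succ m, mul_add, Finset.sum_add_distrib, sub_eq_add_neg (G := ℂ)]
      congr 1
      rw [Finset.sum_range_succ', ← Finset.sum_neg_distrib]
      simp only [Nat.cast_zero, zero_sub, ibinom_of_neg (show (-1 : ℤ) < 0 by norm_num), mul_zero,
        add_zero]
      refine Finset.sum_congr rfl fun a _ => ?_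
      push_cast
      rw [show n - ((a : ℤ) + 1) = n - 1 - a by ring,
        show (j : ℤ) + 1 - (a + 1) = j - a by ring, show (a : ℤ) + 1 - 1 = a by ring, pow_succ]
      ring
    have hstep' : ∀ m, ibinom (n - (m + 1)) ((j + 1 : ℕ) : ℤ) =
        ibinom (n - m) ((j + 1 : ℕ) : ℤ) - ibinom (n - 1 - m) j := by
      intro m
      have := ibinom_succ (n - 1 - m) ((j + 1 : ℕ) : ℤ)
      rw [show n - 1 - m + 1 = n - m by ring,
        show (((j + 1 : ℕ) : ℤ)) - 1 = j by push_cast; ring] at this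
      rw [this, show n - (m + 1) = n - 1 - m by ring]
      ring
    change _ = g m
    induction m using Int.induction_on with
    | zero =>
      have h0 : ∀ a : ℕ, ibinom 0 ((a : ℤ) + 1) = 0 := fun a => ibinom_zero_left (by omega)
      rw [hg]
      simp only
      rw [Finset.sum_range_succ']
      simp [h0]
    | succ i hi => rw [hstep', hstep, hi]
    | pred i hi =>
      have h1 := hstep (-i - 1)
      have h2 := hstep' (-i - 1)
      rw [sub_add_cancel] at h1 h2
      rw [h1, h2] at hi
      exact sub_left_injective hi

/-! ### Re-expansion in `y = z - 1` -/

/-- The series `∑ₘ F m ∑ₐ c m a yᵃ`. -/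
def expand (c : ℤ → ℤ → ℂ) (F : ℤ → M) (a : ℤ) : M := ∑ᶠ m, c m a • F m

/-- All sums occurring in `expand c F` are finite. -/
def Expandable (c : ℤ → ℤ → ℂ) (F : ℤ → M) : Prop :=
  ∀ a, (Function.support fun m => c m a • F m).Finite

/-- The coefficients of the powers `(1 + y)^m` for some way of expanding them. -/
def IsPascal (c : ℤ → ℤ → ℂ) : Prop := ∀ m a, c (m + 1) a = c m a + c m (a - 1)

/-- The coefficient of `y^a` in the expansion of `(1 + y)^m` at `y = ∞`. -/
def binomInf (m a : ℤ) : ℂ := ibinom m (m - a)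

lemma isPascal_ibinom : IsPascal ibinom := ibinom_succ

lemma isPascal_binomInf : IsPascal binomInf := fun m a => by
  rw [binomInf, ibinom_succ, binomInf, binomInf, add_comm]
  congr 2 <;> ring

variable {c : ℤ → ℤ → ℂ} {F G : ℤ → M}

lemma Expandable.of_finite (hF : (Function.support F).Finite) : Expandable c F := fun a =>
  hF.subset fun m hm h => hm (by simp [h])

lemma Expandable.sub (hF : Expandable c F) (hG : Expandable c G) : Expandable c (F - G) :=
  fun a => ((hF a).union (hG a)).subset fun m hm => by
    simp only [Set.mem_union, Function.mem_support, Pi.sub_apply, smul_sub] at hm ⊢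
    by_contra! h
    exact hm (by rw [h.1, h.2, sub_zero])

lemma expand_sub (hF : Expandable c F) (hG : Expandable c G) :
    expand c (F - G) = expand c F - expand c G := by
  funext a
  simp only [expand, Pi.sub_apply, smul_sub]
  exact finsum_sub_distrib (hF a) (hG a)

lemma Expandable.shift (hc : IsPascal c) (hF : Expandable c F) : Expandable c (shift F) := by
  intro a
  refine (((hF a).union (hF (a - 1))).image (· + 1)).subset fun m hm => ⟨m - 1, ?_, by simp⟩
  have h1 := hc (m - 1) a
  rw [sub_add_cancel] at h1
  simp only [Set.mem_union, Function.mem_support, shift_apply, h1, add_smul] at hm ⊢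
  by_contra! h
  exact hm (by rw [h.1, h.2, add_zero])

lemma expand_shift (hc : IsPascal c) (hF : Expandable c F) :
    expand c (NVA.shift F) = (NVA.shift + 1 : Module.End ℂ (ℤ → M)) (expand c F) := by
  funext a
  rw [shift_add_one_apply, add_comm]
  simp only [expand]
  rw [← finsum_add_distrib (hF a) (hF (a - 1)), ← finsum_comp_equiv (Equiv.addRight (1 : ℤ))]
  refine finsum_congr fun m => ?_
  simp [hc m a, add_smul]

lemma Expandable.delta (hc : IsPascal c) (hF : Expandable c F) : Expandable c (delta F) :=
  (hF.shift hc).sub hF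

lemma expand_delta (hc : IsPascal c) (hF : Expandable c F) :
    expand c (NVA.delta F) = NVA.shift (expand c F) := by
  rw [delta_eq_sub, expand_sub (hF.shift hc) hF, expand_shift hc hF]
  simp

lemma Expandable.shift_pow (hc : IsPascal c) (hF : Expandable c F) (l : ℕ) :
    Expandable c ((NVA.shift ^ l) F) := by
  induction l with
  | zero => simpa
  | succ l ih => rw [pow_succ', Module.End.mul_apply]; exact ih.shift hc

lemma Expandable.delta_pow (hc : IsPascal c) (hF : Expandable c F) (l : ℕ) :
    Expandable c ((NVA.delta ^ l) F) := by
  induction l with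
  | zero => simpa
  | succ l ih => rw [pow_succ', Module.End.mul_apply]; exact ih.delta hc

lemma expand_shift_pow (hc : IsPascal c) (hF : Expandable c F) (l : ℕ) :
    expand c ((NVA.shift ^ l) F) =
      ((NVA.shift + 1 : Module.End ℂ (ℤ → M)) ^ l) (expand c F) := by
  induction l with
  | zero => simp
  | succ l ih =>
    rw [pow_succ', Module.End.mul_apply, expand_shift hc (hF.shift_pow hc l), ih, pow_succ',
      Module.End.mul_apply]

lemma expand_delta_pow (hc : IsPascal c) (hF : Expandable c F) (l : ℕ) :
    expand c ((NVA.delta ^ l) F) = (NVA.shift ^ l) (expand c F) := by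
  induction l with
  | zero => simp
  | succ l ih =>
    rw [pow_succ', Module.End.mul_apply, expand_delta hc (hF.delta_pow hc l), ih, pow_succ',
      Module.End.mul_apply]

lemma expand_sum {ι : Type*} (s : Finset ι) (G : ι → ℤ → M) (b : ι → ℂ)
    (hG : ∀ i ∈ s, Expandable c (G i)) :
    expand c (∑ i ∈ s, b i • G i) = ∑ i ∈ s, b i • expand c (G i) := by
  funext a
  simp only [expand, Finset.sum_apply, Pi.smul_apply, Finset.smul_sum, smul_comm (c _ a)]
  rw [finsum_sum_comm]
  · refine Finset.sum_congr rfl fun i hi => ?_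
    rw [smul_finsum' _ (hG i hi a)]
  · exact fun i hi => (hG i hi a).subset fun m hm h => hm (by simp only at h ⊢; rw [h, smul_zero])

/-- Truncation above and below gives finite support. -/
lemma finite_support_of_bounds {E : Type*} [Zero E] {F : ℤ → E} {N N' : ℤ}
    (h : ∀ m < N, F m = 0) (h' : ∀ m > N', F m = 0) :
    (Function.support F).Finite :=
  (Set.finite_Icc N N').subset fun m hm =>
    ⟨not_lt.1 fun hlt => hm (h m hlt), not_lt.1 fun hlt => hm (h' m hlt)⟩

lemma binomInf_of_lt {m a : ℤ} (h : m < a) : binomInf m a = 0 := ibinom_of_neg (by omega)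

lemma expandable_binomInf {N : ℤ} (hN : ∀ m > N, F m = 0) : Expandable binomInf F := fun a =>
  finite_support_of_bounds (N := a) (N' := N) (fun m hm => by simp [binomInf_of_lt hm])
    (fun m hm => by simp [hN m hm])

lemma expand_binomInf_of_gt {N : ℤ} (hN : ∀ m > N, F m = 0) :
    ∀ a > N, expand binomInf F a = 0 := by
  refine fun a ha => finsum_eq_zero_of_forall_eq_zero fun m => ?_
  rcases lt_or_ge m a with h | h
  · simp [binomInf_of_lt h]
  · simp [hN m (by omega)]

lemma eq_zero_of_expand_binomInf {N : ℤ} (hN : ∀ m > N, F m = 0) (h : expand binomInf F = 0) :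
    F = 0 := by
  by_contra hF
  obtain ⟨m₀, hm₀⟩ := Function.ne_iff.1 hF
  obtain ⟨m, hm, hmax⟩ := Int.exists_greatest_of_bdd (P := fun m => F m ≠ 0)
    ⟨N, fun m hm => not_lt.1 fun hlt => hm (hN m hlt)⟩ ⟨m₀, hm₀⟩
  have h1 := congrFun h m
  rw [expand, finsum_eq_single _ m] at h1
  · simp only [binomInf, sub_self, ibinom_zero_right, one_smul] at h1
    exact hm h1
  · intro n hn
    rcases lt_or_gt_of_ne hn with h | h
    · simp [binomInf_of_lt h]
    · have : F n = 0 := by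
        by_contra h2
        exact absurd (hmax n h2) (by omega)
      simp [this]

lemma binomInf_of_nonneg {m : ℤ} (hm : 0 ≤ m) (a : ℤ) : binomInf m a = ibinom m a :=
  ibinom_symm hm a

lemma eq_zero_of_neg_of_expand_binomInf (h : ∀ a < 0, expand binomInf F a = 0) :
    ∀ m < 0, F m = 0 := by
  set G : ℤ → M := fun m => if m < 0 then F m else 0 with hG
  have hG0 : ∀ m > -1, G m = 0 := fun m hm => if_neg (by omega)
  have : G = 0 := by
    refine eq_zero_of_expand_binomInf hG0 (funext fun a => ?_)
    rcases lt_or_ge a 0 with ha | ha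
    · rw [Pi.zero_apply, ← h a ha]
      refine finsum_congr fun m => ?_
      rcases lt_or_ge m 0 with hm | hm
      · simp [hG, hm]
      · rw [binomInf_of_nonneg hm, ibinom_of_neg ha, zero_smul, zero_smul]
    · exact expand_binomInf_of_gt hG0 a (by omega)
  intro m hm
  have h1 := congrFun this m
  simpa [hG, hm] using h1

lemma expand_binomInf_eq (hF : ∀ m < 0, F m = 0) : expand binomInf F = expand ibinom F := by
  funext a
  refine finsum_congr fun m => ?_
  rcases lt_or_ge m 0 with hm | hm
  · simp [hF m hm]
  · rw [binomInf_of_nonneg hm]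

lemma expand_ibinom_of_neg (F : ℤ → M) {a : ℤ} (ha : a < 0) : expand ibinom F a = 0 :=
  finsum_eq_zero_of_forall_eq_zero fun m => by simp [ibinom_of_neg ha]

lemma delta_pow_of_gt {N : ℤ} (hN : ∀ m > N, F m = 0) (k : ℕ) :
    ∀ m > N + k, (delta ^ k) F m = 0 := by
  induction k with
  | zero => simpa using hN
  | succ k ih =>
    intro m hm
    push_cast at hm
    rw [pow_succ', Module.End.mul_apply, delta_apply, ih _ (by omega), ih _ (by omega), sub_zero]

lemma finite_support_delta_pow (hF : (Function.support F).Finite) (k : ℕ) :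
    (Function.support ((delta ^ k) F)).Finite := by
  induction k with
  | zero => simpa
  | succ k ih =>
    rw [pow_succ', Module.End.mul_apply]
    refine ((ih.image (· + 1)).union ih).subset fun m hm => ?_
    by_contra! h
    simp only [Set.mem_union, Set.mem_image, Function.mem_support, not_or, not_exists,
      not_and] at h
    have h1 : (delta ^ k) F (m - 1) = 0 := by
      by_contra h2
      exact h.1 (m - 1) h2 (by simp)
    exact hm (by rw [delta_apply, h1, not_not.1 h.2, sub_zero])

lemma exists_bounds_of_finite_support {E : Type*} [Zero E] {F : ℤ → E}
    (hF : (Function.support F).Finite) :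
    ∃ n : ℕ, (∀ m < -(n : ℤ), F m = 0) ∧ ∀ m > (n : ℤ), F m = 0 := by
  obtain ⟨a, ha⟩ := hF.bddBelow
  obtain ⟨b, hb⟩ := hF.bddAbove
  refine ⟨(max (-a) b).toNat, fun m hm => ?_, fun m hm => ?_⟩
  · by_contra h
    have := ha h
    omega
  · by_contra h
    have := hb h
    omega

lemma eq_zero_of_expand_ibinom (hF : (Function.support F).Finite) (h : expand ibinom F = 0) :
    F = 0 := by
  obtain ⟨n, hn, hn'⟩ := exists_bounds_of_finite_support hF
  refine shift_pow_injective n ?_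
  rw [map_zero]
  refine eq_zero_of_expand_binomInf (N := 2 * n) (fun m hm => ?_) ?_
  · rw [shift_pow_apply, hn' _ (by omega)]
  · rw [expand_binomInf_eq, expand_shift_pow isPascal_ibinom (.of_finite hF), h, map_zero]
    intro m hm
    rw [shift_pow_apply, hn _ (by omega)]

/-- A series `F` in `z⁻¹` whose expansion in `y = z - 1` at infinity agrees, up to a power of
`z = 1 + y`, with a series `C` in `y`, is the expansion of `(z - 1)^{-k}` times a Laurent
polynomial in `z`, whose expansion at `y = 0` is `C`. -/
theorem expansion_of_assoc {C : ℤ → M} {N : ℤ} (hN : ∀ m > N, F m = 0) {k l : ℕ}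
    (hC : ∀ a < -(k : ℤ), C a = 0)
    (h : ((shift + 1 : Module.End ℂ (ℤ → M)) ^ l) (expand binomInf F) =
      ((shift + 1 : Module.End ℂ (ℤ → M)) ^ l) C) :
    (Function.support ((delta ^ k) F)).Finite ∧
      expand ibinom ((delta ^ k) F) = (shift ^ k) C := by
  have hF := expandable_binomInf hN
  have hcomm : Commute ((shift + 1 : Module.End ℂ (ℤ → M)) ^ l) (shift ^ k) :=
    (((Commute.refl _).add_left (Commute.one_left _)).pow_pow l k)
  have hkC : ∀ a < 0, (shift ^ k) C a = 0 := fun a ha => by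
    rw [shift_pow_apply, hC _ (by omega)]
  have hexp : expand binomInf ((shift ^ l) ((delta ^ k) F)) =
      ((shift + 1 : Module.End ℂ (ℤ → M)) ^ l) ((shift ^ k) C) := by
    rw [expand_shift_pow isPascal_binomInf (hF.delta_pow isPascal_binomInf k),
      expand_delta_pow isPascal_binomInf hF, ← Module.End.mul_apply, hcomm.eq,
      Module.End.mul_apply, h, ← Module.End.mul_apply, ← hcomm.eq, Module.End.mul_apply]
  have htop := delta_pow_of_gt hN k
  have hpoly : ∀ m < 0, (shift ^ l) ((delta ^ k) F) m = 0 := by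
    refine eq_zero_of_neg_of_expand_binomInf fun a ha => ?_
    rw [hexp, shift_add_one_pow_apply]
    refine Finset.sum_eq_zero fun i hi => ?_
    have := Finset.mem_range.1 hi
    rw [hkC _ (by omega), smul_zero]
  have hfin : (Function.support ((delta ^ k) F)).Finite := by
    refine finite_support_of_bounds (N := -l) (fun m hm => ?_) htop
    have := hpoly (m + l) (by omega)
    rwa [shift_pow_apply, add_sub_cancel_right] at this
  refine ⟨hfin, sub_eq_zero.1 <| eq_zero_of_shift_add_one_pow (N := 0) (l := l) (fun a ha => ?_) ?_⟩
  · rw [Pi.sub_apply, expand_ibinom_of_neg _ ha, hkC a ha, sub_zero]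
  · rw [map_sub, ← expand_shift_pow isPascal_ibinom (.of_finite hfin), ← expand_binomInf_eq hpoly,
      hexp, sub_self]

/-- In the situation of `expansion_of_assoc`, `F` vanishes if it is truncated too low. -/
theorem eq_zero_of_assoc {C : ℤ → M} {N : ℤ} (hN : ∀ m > N, F m = 0) {k l : ℕ}
    (hC : ∀ a < -(k : ℤ), C a = 0)
    (h : ((shift + 1 : Module.End ℂ (ℤ → M)) ^ l) (expand binomInf F) =
      ((shift + 1 : Module.End ℂ (ℤ → M)) ^ l) C) (hlow : N + l < -k) : F = 0 := by
  have hN' : ∀ m > N + l, (shift ^ l) F m = 0 := fun m hm => by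
    rw [shift_pow_apply, hN _ (by omega)]
  refine shift_pow_injective l ?_
  rw [map_zero]
  refine eq_zero_of_expand_binomInf hN' (funext fun a => ?_)
  rcases lt_or_ge (N + l) a with ha | ha
  · exact expand_binomInf_of_gt hN' a ha
  · rw [expand_shift_pow isPascal_binomInf (expandable_binomInf hN), h, shift_add_one_pow_apply]
    refine Finset.sum_eq_zero fun i hi => ?_
    have := Finset.mem_range.1 hi
    rw [hC _ (by omega), smul_zero]

/-! ### The inversion `z ↦ z⁻¹` -/

/-- The substitution `z ↦ z⁻¹` followed by multiplication by `z^n`. -/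
def reflect {E : Type*} (n : ℤ) (F : ℤ → E) : ℤ → E := fun m => F (n - m)

lemma delta_pow_reflect (n : ℤ) (F : ℤ → M) (k : ℕ) :
    (delta ^ k) (reflect n F) = (-1 : ℂ) ^ k • reflect (n + k) ((delta ^ k) F) := by
  induction k with
  | zero => simp
  | succ k ih =>
    simp only [pow_succ' delta, Module.End.mul_apply, ih, map_smul]
    rw [pow_succ, mul_smul]
    funext m
    simp only [Pi.smul_apply, Pi.neg_apply, delta_apply, reflect, neg_smul, one_smul, neg_sub]
    congr 3 <;> · push_cast; ring_nf

lemma finite_support_reflect {E : Type*} [Zero E] {F : ℤ → E} (n : ℤ)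
    (hF : (Function.support F).Finite) :
    (Function.support (reflect n F)).Finite :=
  (hF.image (n - ·)).subset fun m hm => ⟨n - m, hm, by simp⟩

lemma expand_reflect (n : ℤ) (hF : (Function.support F).Finite) (j : ℕ) :
    expand ibinom (reflect n F) j = ∑ a ∈ Finset.range (j + 1),
      ((-1 : ℂ) ^ a * ibinom (n - a) (j - a)) • expand ibinom F a := by
  have h1 : expand ibinom (reflect n F) j = ∑ᶠ m, ∑ a ∈ Finset.range (j + 1),
      ((-1 : ℂ) ^ a * ibinom (n - a) (j - a)) • ibinom m a • F m := by
    rw [expand, ← finsum_comp_equiv (Equiv.subLeft n)]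
    refine finsum_congr fun m => ?_
    simp only [Equiv.subLeft_apply, reflect, sub_sub_cancel, smul_smul]
    rw [← Finset.sum_smul, ← ibinom_sub]
  rw [h1, finsum_sum_comm]
  · refine Finset.sum_congr rfl fun a _ => ?_
    rw [expand, smul_finsum' _ (Expandable.of_finite hF a)]
  · exact fun a _ => hF.subset fun m hm h => hm (by simp [h])

/-! ### Multiplication by `(1 - z)^n` -/

/-- Multiplication by `(1 - z)^n`, expanded in nonnegative powers of `z`. -/
def oneSubPow (n : ℤ) (F : ℤ → M) : ℤ → M :=
  fun m => ∑ᶠ s : ℤ, ((-1 : ℂ) ^ s * ibinom n s) • F (m - s)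

lemma finite_support_oneSubPow {N : ℤ} (hN : ∀ m < N, F m = 0) (n m : ℤ) :
    (Function.support fun s : ℤ => ((-1 : ℂ) ^ s * ibinom n s) • F (m - s)).Finite :=
  finite_support_of_bounds (N := 0) (N' := m - N) (fun s hs => by simp [ibinom_of_neg hs])
    (fun s hs => by simp [hN (m - s) (by omega)])

lemma delta_oneSubPow {N : ℤ} (hN : ∀ m < N, F m = 0) (n : ℤ) :
    delta (oneSubPow n F) = -oneSubPow (n + 1) F := by
  funext m
  rw [delta_apply, Pi.neg_apply, eq_neg_iff_add_eq_zero, sub_add_eq_add_sub, sub_eq_zero]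
  have h1 : oneSubPow n F (m - 1) =
      -∑ᶠ s : ℤ, ((-1 : ℂ) ^ s * ibinom n (s - 1)) • F (m - s) := by
    rw [oneSubPow, ← finsum_neg_distrib, ← finsum_comp_equiv (Equiv.subRight (1 : ℤ))]
    refine finsum_congr fun s => ?_
    rw [Equiv.subRight_apply, show m - 1 - (s - 1) = m - s by ring, ← neg_smul,
      zpow_sub_one₀ (by norm_num)]
    congr 1; ring
  have hfin : (Function.support fun s : ℤ =>
      ((-1 : ℂ) ^ s * ibinom n (s - 1)) • F (m - s)).Finite :=
    finite_support_of_bounds (N := 1) (N' := m - N)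
      (fun s hs => by simp [ibinom_of_neg (show s - 1 < 0 by omega)])
      (fun s hs => by simp [hN (m - s) (by omega)])
  rw [h1, neg_add_eq_iff_eq_add, oneSubPow, oneSubPow,
    ← finsum_add_distrib hfin (finite_support_oneSubPow hN n m)]
  refine finsum_congr fun s => ?_
  rw [ibinom_succ, ← add_smul]
  congr 1; ring

lemma delta_pow_oneSubPow {N : ℤ} (hN : ∀ m < N, F m = 0) (n : ℤ) (j : ℕ) :
    (delta ^ j) (oneSubPow n F) = (-1 : ℂ) ^ j • oneSubPow (n + j) F := by
  induction j with
  | zero => simp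
  | succ j ih =>
    rw [pow_succ', Module.End.mul_apply, ih, map_smul, delta_oneSubPow hN, pow_succ, mul_smul]
    push_cast
    simp [add_assoc]

lemma oneSubPow_zero (F : ℤ → M) : oneSubPow 0 F = F := by
  funext m
  rw [oneSubPow, finsum_eq_single _ 0]
  · simp
  · intro s hs
    simp [ibinom_zero_left hs]

lemma oneSubPow_natCast {N : ℤ} (hN : ∀ m < N, F m = 0) (j : ℕ) :
    oneSubPow j F = (-1 : ℂ) ^ j • (delta ^ j) F := by
  have h := delta_pow_oneSubPow hN 0 j
  rw [oneSubPow_zero, zero_add] at h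
  rw [h, smul_smul, ← mul_pow]
  simp

lemma delta_pow_oneSubPow_of_nonneg {N : ℤ} (hN : ∀ m < N, F m = 0) {n : ℤ} {K : ℕ}
    (h : 0 ≤ n + K) :
    (delta ^ K) (oneSubPow n F) = (-1 : ℂ) ^ n • (delta ^ (n + K).toNat) F := by
  obtain ⟨j, hj⟩ := Int.eq_ofNat_of_zero_le h
  rw [delta_pow_oneSubPow hN, hj, Int.toNat_natCast, oneSubPow_natCast hN, smul_smul]
  congr 1
  rw [show n = (j : ℤ) - K by omega, zpow_sub₀ (by norm_num), zpow_natCast, zpow_natCast,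
    div_eq_mul_inv, ← inv_pow, mul_comm]
  norm_num

end Expansion

section Families

variable {M : Type*} [AddCommGroup M] [Module ℂ M]

/-! ### Homogeneous components of two-variable families -/

/-- The component of total degree `d` of a two-variable family in `x₁, x₂`, as a series in
`z = x₁ / x₂`. -/
def degPart (F : ℤ → ℤ → M) (d : ℤ) : ℤ → M := fun m => F m (d - m)

lemma mulPoly_eq_sum {p : MvPolynomial (Fin 2) ℂ} {s : Finset (Fin 2 →₀ ℕ)} (hs : p.support ⊆ s)
    (F : ℤ → ℤ → M) (m t : ℤ) :
    mulPoly p F m t = ∑ d ∈ s, MvPolynomial.coeff d p • F (m - d 0) (t - d 1) :=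
  Finset.sum_subset hs fun d _ hd => by
    rw [MvPolynomial.notMem_support_iff.1 hd, zero_smul]

lemma mulPoly_sub (p q : MvPolynomial (Fin 2) ℂ) (F : ℤ → ℤ → M) (m t : ℤ) :
    mulPoly (p - q) F m t = mulPoly p F m t - mulPoly q F m t := by
  rw [mulPoly_eq_sum (MvPolynomial.support_sub _ p q),
    mulPoly_eq_sum (Finset.subset_union_left (s₂ := q.support)),
    mulPoly_eq_sum (Finset.subset_union_right (s₁ := p.support)), ← Finset.sum_sub_distrib]
  simp [sub_smul]

lemma mulPoly_mul_X (p : MvPolynomial (Fin 2) ℂ) (i : Fin 2) (F : ℤ → ℤ → M) (m t : ℤ) :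
    mulPoly (p * MvPolynomial.X i) F m t =
      mulPoly p F (m - ((Finsupp.single i 1 : Fin 2 →₀ ℕ) 0 : ℤ))
        (t - ((Finsupp.single i 1 : Fin 2 →₀ ℕ) 1 : ℤ)) := by
  rw [mulPoly, MvPolynomial.support_mul_X, Finset.sum_map]
  refine Finset.sum_congr rfl fun d _ => ?_
  simp only [addRightEmbedding_apply, MvPolynomial.coeff_mul_X, Finsupp.add_apply]
  congr 2 <;> · push_cast; ring

lemma mulPoly_sub_pow (k : ℕ) (F : ℤ → ℤ → M) (m t : ℤ) :
    mulPoly ((MvPolynomial.X 0 - MvPolynomial.X 1) ^ k) F m t =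
      (delta ^ k) (degPart F (m + t - k)) m := by
  induction k generalizing m t with
  | zero =>
    have h1 : (1 : MvPolynomial (Fin 2) ℂ).support ⊆ {0} :=
      MvPolynomial.support_monomial_subset
    rw [pow_zero, mulPoly_eq_sum h1]
    simp [degPart]
  | succ k ih =>
    rw [pow_succ, mul_sub, mulPoly_sub, mulPoly_mul_X, mulPoly_mul_X, ih, ih, pow_succ' delta,
      Module.End.mul_apply, delta_apply]
    congr 3 <;> · simp; try ring_nf

lemma mulSubPoly_X_pow (l : ℕ) (F : ℤ → ℤ → M) (a b : ℤ) :
    mulSubPoly (MvPolynomial.X 0 ^ l) F a b =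
      ((shift + 1 : Module.End ℂ (ℤ → M)) ^ l) (degPart F (a + b - l)) a := by
  rw [shift_add_one_pow_apply, mulSubPoly, MvPolynomial.X_pow_eq_monomial,
    MvPolynomial.support_monomial, if_neg one_ne_zero, Finset.sum_singleton]
  simp only [Finsupp.single_eq_same, MvPolynomial.coeff_monomial, if_true, one_mul, degPart]
  refine Finset.sum_congr rfl fun i _ => ?_
  congr 2
  simp
  ring

end Families

section Modules

variable {V W : Type*} [AddCommGroup V] [Module ℂ V] [AddCommGroup W] [Module ℂ W]

/-! ### Products and iterates in a fixed total degree -/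

/-- The linear map `v ↦ v_n w`. -/
def modeLin (YW : V →ₗ[ℂ] EW W) (w : W) (n : ℤ) : V →ₗ[ℂ] W where
  toFun v := YWf YW v w n
  map_add' := by intro v v'; simp [YWf, mf]
  map_smul' := by intro c v; simp [YWf, mf]

lemma modeLin_apply (YW : V →ₗ[ℂ] EW W) (w : W) (n : ℤ) (v : V) :
    modeLin YW w n v = YWf YW v w n := rfl

@[simp] lemma YWf_zero_right (YW : V →ₗ[ℂ] EW W) (v : V) (n : ℤ) : YWf YW v 0 n = 0 := by
  simp [YWf, mf]

@[simp] lemma YWf_zero_left (YW : V →ₗ[ℂ] EW W) (w : W) (n : ℤ) : YWf YW 0 w n = 0 := by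
  simp [YWf, mf]

lemma exists_trunc (YW : V →ₗ[ℂ] EW W) (v : V) (w : W) : ∃ N : ℤ, ∀ n ≥ N, YWf YW v w n = 0 :=
  (YW v).2 w

/-- The component of total degree `d` of `Y_W(u,x₁)Y_W(v,x₂)w`, in powers of `x₁ / x₂`. -/
def prodDeg (YW : V →ₗ[ℂ] EW W) (u v : V) (w : W) (d : ℤ) : ℤ → W :=
  fun m => YWf YW u (YWf YW v w (-(d - m) - 1)) (-m - 1)

/-- The component of total degree `d` of `Y_W(Y(u,x₀)v,x₂)w`, in powers of `x₀ / x₂`. -/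
def iterDeg (A : NLVA V) (YW : V →ₗ[ℂ] EW W) (u v : V) (w : W) (d : ℤ) : ℤ → W :=
  fun a => YWf YW (Yf A u v (-a - 1)) w (-(d - a) - 1)

lemma degPart_prodCE (YW : V →ₗ[ℂ] EW W) (u v : V) (w : W) (d : ℤ) :
    degPart (prodCE (YWf YW) (YWf YW) u v w) d = expand binomInf (prodDeg YW u v w d) := by
  funext a
  refine finsum_congr fun m => ?_
  simp only [binomInf, ibinom, sub_nonneg, ite_smul, zero_smul, prodDeg]
  congr 5
  ring

variable {A : NLVA V} {YW : V →ₗ[ℂ] EW W}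

lemma IsModule.exists_assoc (hmod : IsModule A YW) (u v : V) (w : W) : ∃ l : ℕ, ∀ d : ℤ,
    ((shift + 1 : Module.End ℂ (ℤ → W)) ^ l) (expand binomInf (prodDeg YW u v w d)) =
      ((shift + 1 : Module.End ℂ (ℤ → W)) ^ l) (iterDeg A YW u v w d) := by
  obtain ⟨l, hl⟩ := hmod.2 u v w
  refine ⟨l, fun d => funext fun a => ?_⟩
  have h := hl a (d + l - a)
  rw [mulSubPoly_X_pow, mulSubPoly_X_pow, show a + (d + l - a) - l = d by ring,
    degPart_prodCE] at h
  exact h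

/-- In every total degree, the product `Y_W(u,x₁)Y_W(v,x₂)w` is the expansion at `z = ∞`
(`z = x₁ / x₂`) of `(z - 1)^{-k}` times a Laurent polynomial, whose expansion at `z = 1`
is the iterate. -/
theorem IsModule.expand_prodDeg (hmod : IsModule A YW) {u v : V} {k : ℕ}
    (hk : ∀ n ≥ (k : ℤ), Yf A u v n = 0) (w : W) (d : ℤ) :
    (Function.support ((delta ^ k) (prodDeg YW u v w d))).Finite ∧
      expand ibinom ((delta ^ k) (prodDeg YW u v w d)) =
        (shift ^ k) (iterDeg A YW u v w d) := by
  obtain ⟨N, hN⟩ := exists_trunc YW v w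
  obtain ⟨l, hl⟩ := hmod.exists_assoc u v w
  refine expansion_of_assoc (N := d + N) (fun m hm => ?_) (fun a ha => ?_) (hl d)
  · rw [prodDeg, hN _ (by omega), YWf_zero_right]
  · rw [iterDeg, hk _ (by omega), YWf_zero_left]

theorem IsModule.prodDeg_eq_zero (hmod : IsModule A YW) (u v : V) (w : W) :
    ∃ N : ℤ, ∀ d < N, prodDeg YW u v w d = 0 := by
  obtain ⟨N, hN⟩ := exists_trunc YW v w
  obtain ⟨k₀, hk₀⟩ := exists_trunc A.Y u v
  obtain ⟨l, hl⟩ := hmod.exists_assoc u v w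
  refine ⟨-N - l - k₀.toNat, fun d hd => ?_⟩
  refine eq_zero_of_assoc (N := d + N) (k := k₀.toNat) (fun m hm => ?_) (fun a ha => ?_) (hl d)
    (by omega)
  · rw [prodDeg, hN _ (by omega), YWf_zero_right]
  · rw [iterDeg, show Yf A u v (-a - 1) = 0 from hk₀ _ (by omega), YWf_zero_left]

/-! ### The operator `𝒟` -/

lemma IsModule.YWf_Dmap (hmod : IsModule A YW) (v : V) (w : W) (b : ℤ) :
    YWf YW (Dmap A v) w (-b - 1) = ((b : ℂ) + 1) • YWf YW v w (-(b + 1) - 1) := by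
  have h := (hmod.expand_prodDeg (k := 0) (u := v) (v := A.one) (A.creation0 v) w (b + 1)).2
  have h1 := congrFun h 1
  simp only [pow_zero, Module.End.one_apply] at h1
  rw [iterDeg, expand, finsum_eq_single _ (b + 1)] at h1
  · rw [prodDeg, YWf, YWf, hmod.1, if_pos (by ring), ← Nat.cast_one, ibinom_natCast,
      binom_succ_right, binom_zero_right] at h1
    rw [Dmap, YWf, YWf, show (-2 : ℤ) = -1 - 1 by norm_num, show -b - 1 = -(b + 1 - 1) - 1 by ring]
    simpa [YWf] using h1.symm
  · intro m hm
    rw [prodDeg, show YWf YW A.one w (-(b + 1 - m) - 1) = 0 from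
      (hmod.1 _ _).trans (if_neg (by omega)), YWf_zero_right, smul_zero]

lemma IsModule.YWf_Dmap_iterate (hmod : IsModule A YW) (n : ℕ) (v : V) (w : W) (b : ℤ) :
    YWf YW ((Dmap A)^[n] v) w (-b - 1) =
      ((n.factorial : ℂ) * binom (b + n) n) • YWf YW v w (-(b + n) - 1) := by
  induction n generalizing v b with
  | zero => simp [binom_zero_right]
  | succ n ih =>
    have h2 : (n + 1 : ℂ) ≠ 0 := by exact_mod_cast n.succ_ne_zero
    rw [Function.iterate_succ_apply, ih, hmod.YWf_Dmap, smul_smul, Nat.factorial_succ,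
      Nat.cast_succ, ← add_assoc, binom_succ_succ_mul]
    congr 1
    push_cast
    field_simp

lemma expDY_eq_sum (A : NLVA V) {v u : V} {k : ℕ} (hk : ∀ n ≥ (k : ℤ), Yf A v u n = 0) (j : ℤ) :
    expDY A v u j = ∑ q ∈ Finset.Icc (-(k : ℤ)) j,
      ((((j - q).toNat.factorial : ℂ))⁻¹ * (-1 : ℂ) ^ q) •
        (Dmap A)^[(j - q).toNat] (Yf A v u (-q - 1)) := by
  have hD : ∀ n, (Dmap A)^[n] 0 = 0 := fun n =>
    Function.iterate_fixed (by simp [Dmap, Yf, mf]) n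
  rw [expDY, finsum_eq_sum_of_support_subset (s := Finset.Icc (-(k : ℤ)) j)]
  · exact Finset.sum_congr rfl fun q hq => if_pos (Finset.mem_Icc.1 hq).2
  · intro q hq
    rw [Finset.mem_coe, Finset.mem_Icc]
    refine ⟨not_lt.1 fun h => hq ?_, not_lt.1 fun h => hq (if_neg (by omega))⟩
    simp only
    rw [hk _ (by omega), hD, smul_zero, ite_self]

lemma IsModule.YWf_expDY (hmod : IsModule A YW) {v u : V} {k : ℕ}
    (hk : ∀ n ≥ (k : ℤ), Yf A v u n = 0) (w : W) (d j : ℤ) :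
    YWf YW (expDY A v u j) w (-(d - j) - 1) = ∑ q ∈ Finset.Icc (-(k : ℤ)) j,
      ((-1 : ℂ) ^ q * ibinom (d - q) (j - q)) • iterDeg A YW v u w d q := by
  rw [expDY_eq_sum A hk, ← modeLin_apply, map_sum]
  refine Finset.sum_congr rfl fun q hq => ?_
  obtain ⟨n, hn⟩ := Int.eq_ofNat_of_zero_le (sub_nonneg.2 (Finset.mem_Icc.1 hq).2)
  have h0 : (n.factorial : ℂ) ≠ 0 := by exact_mod_cast n.factorial_ne_zero
  rw [map_smul, modeLin_apply, hmod.YWf_Dmap_iterate, hn, Int.toNat_natCast, ibinom_natCast,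
    smul_smul, iterDeg, show d - j + n = d - q by omega]
  congr 1
  field_simp

/-- In every total degree, the opposite product `Y_W(v,x₂)Y_W(u,x₁)w` is the expansion at `z = 0`
(`z = x₁ / x₂`) of `(z - 1)^{-k}` times a Laurent polynomial, whose expansion at `z = 1` is
`Y_W(e^{x₀𝒟}Y(v,-x₀)u,x₂)w`. -/
theorem IsModule.expand_reflect_prodDeg (hmod : IsModule A YW) {v u : V} {k : ℕ}
    (hk : ∀ n ≥ (k : ℤ), Yf A v u n = 0) (w : W) (d : ℤ) :
    (Function.support ((delta ^ k) (reflect d (prodDeg YW v u w d)))).Finite ∧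
      expand ibinom ((delta ^ k) (reflect d (prodDeg YW v u w d))) =
        (shift ^ k) fun q => YWf YW (expDY A v u q) w (-(d - q) - 1) := by
  obtain ⟨hfin, hexp⟩ := hmod.expand_prodDeg hk w d
  have hfin' := finite_support_reflect (d + k) hfin
  rw [delta_pow_reflect]
  refine ⟨hfin'.subset (Function.support_const_smul_subset _ _), funext fun j => ?_⟩
  rw [shift_pow_apply, hmod.YWf_expDY hk]
  rcases lt_or_ge j 0 with hj | hj
  · rw [expand_ibinom_of_neg _ hj, Finset.Icc_eq_empty (by omega), Finset.sum_empty]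
  lift j to ℕ using hj
  have hsmul : expand ibinom ((-1 : ℂ) ^ k • reflect (d + k) ((delta ^ k) (prodDeg YW v u w d))) =
      (-1 : ℂ) ^ k • expand ibinom (reflect (d + k) ((delta ^ k) (prodDeg YW v u w d))) := by
    simpa using expand_sum {()} (fun _ => reflect (d + k) ((delta ^ k) (prodDeg YW v u w d)))
      (fun _ => (-1 : ℂ) ^ k) fun _ _ => Expandable.of_finite hfin'
  rw [hsmul, Pi.smul_apply, expand_reflect _ hfin, hexp, Finset.smul_sum]
  refine Finset.sum_nbij' (fun a => (a : ℤ) - k) (fun q => (q + k).toNat) ?_ ?_ ?_ ?_ ?_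
  · intro a ha
    have := Finset.mem_range.1 ha
    exact Finset.mem_Icc.2 ⟨by omega, by omega⟩
  · intro q hq
    have := Finset.mem_Icc.1 hq
    exact Finset.mem_range.2 (by omega)
  · intro a _; simp
  · intro q hq
    have := Finset.mem_Icc.1 hq
    change ((q + k).toNat : ℤ) - k = q
    omega
  · intro a _
    rw [shift_pow_apply, smul_smul, zpow_sub₀ (by norm_num), zpow_natCast, zpow_natCast,
      div_eq_mul_inv, ← inv_pow, show d + (k : ℤ) - a = d - (a - k) by ring,
      show (j : ℤ) - a = j - k - (a - k) by ring]
    congr 1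
    norm_num
    ring

end Modules

section Locality

variable {M : Type*} [AddCommGroup M] [Module ℂ M]

/-! ### Multiplication by `f(x₂ - x₁)` -/

lemma degPart_smulFam_expandSub {f : LC} {G : ℤ → ℤ → M} {K : ℕ} {L N : ℤ}
    (hf : ∀ n < -(K : ℤ), f.coeff n = 0) (hL : ∀ m < L, ∀ t, G m t = 0)
    (hN : ∀ d < N, degPart G d = 0) (d : ℤ) :
    degPart (smulFam (expandSub f) G) d = ∑ n ∈ Finset.Icc (-(K : ℤ)) (d - N),
      f.coeff n • oneSubPow n (degPart G (d - n)) := by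
  funext m
  let g : ℤ × ℤ → M := fun p =>
    f.coeff p.1 • ((-1 : ℂ) ^ p.2 * ibinom p.1 p.2) • degPart G (d - p.1) (m - p.2)
  let e : ℤ × ℤ ≃ ℤ × ℤ :=
    ⟨fun p => (p.2, p.1 - p.2), fun s => (s.1 + s.2, s.1), fun p => by simp, fun s => by simp⟩
  have hg : degPart (smulFam (expandSub f) G) d m = ∑ᶠ p, g p := by
    rw [degPart, smulFam, ← finsum_comp_equiv e]
    refine finsum_congr fun p => ?_
    simp only [e, g, Equiv.coe_fn_mk, expandSub, ibinom, degPart, sub_add_cancel, smul_smul]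
    rw [show d - m - (p.1 - p.2) = d - p.1 - (m - p.2) by ring]
    congr 1
    split_ifs with h
    · obtain ⟨s, hs⟩ := Int.eq_ofNat_of_zero_le h
      rw [hs, Int.toNat_natCast, zpow_natCast]
      ring
    · simp
  have hsupp : ∀ p, g p ≠ 0 → p ∈ Finset.Icc (-(K : ℤ)) (d - N) ×ˢ Finset.Icc 0 (m - L) := by
    intro p hp
    rw [Finset.mem_product, Finset.mem_Icc, Finset.mem_Icc]
    refine ⟨⟨?_, ?_⟩, ?_, ?_⟩ <;> refine not_lt.1 fun h => hp ?_
    · simp [g, hf _ h]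
    · simp [g, hN (d - p.1) (by omega)]
    · simp [g, ibinom_of_neg h]
    · simp [g, degPart, hL (m - p.2) (by omega)]
  rw [hg, finsum_curry g ((Finset.finite_toSet _).subset hsupp), Finset.sum_apply,
    finsum_eq_sum_of_support_subset (s := Finset.Icc (-(K : ℤ)) (d - N))]
  · refine Finset.sum_congr rfl fun n _ => ?_
    rw [Pi.smul_apply, oneSubPow, smul_finsum]
  · intro n hn
    obtain ⟨s, hs⟩ : ∃ s, g (n, s) ≠ 0 := by
      by_contra! h
      exact hn (by simp only [h, finsum_zero])
    exact (Finset.mem_product.1 (hsupp (n, s) hs)).1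

lemma delta_pow_degPart_smulFam {f : LC} {G : ℤ → ℤ → M} {K : ℕ} {L N : ℤ}
    (hf : ∀ n < -(K : ℤ), f.coeff n = 0) (hL : ∀ m < L, ∀ t, G m t = 0)
    (hN : ∀ d < N, degPart G d = 0) (k : ℕ) (d : ℤ) :
    (delta ^ (K + k)) (degPart (smulFam (expandSub f) G) d) =
      ∑ n ∈ Finset.Icc (-(K : ℤ)) (d - N), (f.coeff n * (-1 : ℂ) ^ n) •
        (delta ^ (n + K).toNat) ((delta ^ k) (degPart G (d - n))) := by
  rw [degPart_smulFam_expandSub hf hL hN, map_sum]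
  refine Finset.sum_congr rfl fun n hn => ?_
  have hn0 : 0 ≤ n + K := by have := Finset.mem_Icc.1 hn; omega
  rw [map_smul, add_comm K k, pow_add, Module.End.mul_apply,
    delta_pow_oneSubPow_of_nonneg (F := degPart G (d - n)) (fun m hm => hL m hm _) hn0, map_smul,
    smul_smul, ← Module.End.mul_apply, ← Module.End.mul_apply, ← pow_add, ← pow_add, add_comm k]

variable {V W : Type*} [AddCommGroup V] [Module ℂ V] [AddCommGroup W] [Module ℂ W]

/-! ### `𝒮`-locality and `𝒮`-skew symmetry -/

/-- The coefficient family of `Y_W(v,x₂)Y_W(u,x₁)w`. -/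
def oppFam (YW : V →ₗ[ℂ] EW W) (v u : V) (w : W) : ℤ → ℤ → W :=
  fun m t => YWf YW v (YWf YW u w (-m - 1)) (-t - 1)

lemma degPart_oppFam (YW : V →ₗ[ℂ] EW W) (v u : V) (w : W) (d : ℤ) :
    degPart (oppFam YW v u w) d = reflect d (prodDeg YW v u w d) := by
  funext m
  simp only [degPart, oppFam, reflect, prodDeg, sub_sub_cancel]

lemma sLocPair_iff {YW : V →ₗ[ℂ] EW W} {k : ℕ} {u v : V} {r : ℕ} {f : Fin r → LC}
    {vi ui : Fin r → V} : sLocPair (YWf YW) k u v f vi ui ↔ ∀ w d,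
      (delta ^ k) (prodDeg YW u v w d) =
        ∑ i, (delta ^ k) (degPart (smulFam (expandSub (f i)) (oppFam YW (vi i) (ui i) w)) d) := by
  refine forall_congr' fun w => ⟨fun h d => funext fun m => ?_, fun h m t => ?_⟩
  · have h1 := h m (d + k - m)
    simp only [mulPoly_sub_pow, show m + (d + k - m) - k = d by ring] at h1
    rw [Finset.sum_apply]
    exact h1
  · simp only [mulPoly_sub_pow]
    have h1 := congrFun (h (m + t - k)) m
    rw [Finset.sum_apply] at h1
    exact h1

lemma sLocPair.mono {YW : V →ₗ[ℂ] EW W} {k l : ℕ} {u v : V} {r : ℕ} {f : Fin r → LC}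
    {vi ui : Fin r → V} (h : sLocPair (YWf YW) k u v f vi ui) (hkl : k ≤ l) :
    sLocPair (YWf YW) l u v f vi ui := by
  obtain ⟨j, rfl⟩ := Nat.exists_eq_add_of_le' hkl
  rw [sLocPair_iff] at h ⊢
  intro w d
  simp only [pow_add, Module.End.mul_apply, h w d, map_sum]

/-- The coefficient of `x^q` in `f(-x) e^{x𝒟} Y(v,-x) u`. -/
def skewTerm (A : NLVA V) (f : LC) (v u : V) (q : ℤ) : V :=
  ∑ᶠ n : ℤ, (f.coeff n * (-1 : ℂ) ^ n) • expDY A v u (q - n)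

variable {A : NLVA V} {YW : V →ₗ[ℂ] EW W}

lemma expDY_eq_zero {v u : V} {k : ℕ} (hk : ∀ n ≥ (k : ℤ), Yf A v u n = 0) {j : ℤ}
    (hj : j < -(k : ℤ)) : expDY A v u j = 0 := by
  rw [expDY_eq_sum A hk, Finset.Icc_eq_empty (by omega), Finset.sum_empty]

lemma IsModule.YWf_skewTerm (hmod : IsModule A YW) {f : LC} {v u : V} {K k : ℕ}
    (hf : ∀ n < -(K : ℤ), f.coeff n = 0) (hk : ∀ n ≥ (k : ℤ), Yf A v u n = 0) {w : W} {N : ℤ}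
    (hN : ∀ d < N, prodDeg YW v u w d = 0) (d q : ℤ) :
    YWf YW (skewTerm A f v u q) w (-(d - q) - 1) =
      ∑ n ∈ Finset.Icc (-(K : ℤ)) (d - N), (f.coeff n * (-1 : ℂ) ^ n) •
        YWf YW (expDY A v u (q - n)) w (-(d - q) - 1) := by
  have hfin : (Function.support fun n => (f.coeff n * (-1 : ℂ) ^ n) • expDY A v u (q - n)).Finite :=
    finite_support_of_bounds (N := -(K : ℤ)) (N' := q + k) (fun n hn => by simp [hf n hn])
      fun n hn => by rw [expDY_eq_zero hk (by omega), smul_zero]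
  rw [skewTerm, ← modeLin_apply, ← LinearMap.toAddMonoidHom_coe, AddMonoidHom.map_finsum _ hfin]
  simp only [LinearMap.toAddMonoidHom_coe, map_smul, modeLin_apply]
  refine finsum_eq_sum_of_support_subset _ fun n hn => ?_
  rw [Finset.mem_coe, Finset.mem_Icc]
  refine ⟨not_lt.1 fun h => hn (by simp [hf n h]), not_lt.1 fun h => hn ?_⟩
  have h1 := congrFun (hmod.expand_reflect_prodDeg hk w (d - n)).2 (q - n + k)
  rw [hN _ (by omega), shift_pow_apply, show d - n - (q - n + k - k) = d - q by ring,
    add_sub_cancel_right] at h1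
  simp only [← h1]
  have h2 : reflect (d - n) (0 : ℤ → W) = 0 := rfl
  simp [h2, expand]

/-- In every total degree, `f(x₂ - x₁)Y_W(v,x₂)Y_W(u,x₁)w` is the expansion of `(z - 1)^{-K-k}`
times a Laurent polynomial, whose expansion at `z = 1` is given by the modes of
`f(-x) e^{x𝒟} Y(v,-x) u`. -/
theorem IsModule.expand_smulFam_oppFam (hmod : IsModule A YW) {f : LC} {v u : V} {K k : ℕ}
    (hf : ∀ n < -(K : ℤ), f.coeff n = 0) (hk : ∀ n ≥ (k : ℤ), Yf A v u n = 0) (w : W) (d : ℤ) :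
    (Function.support
      ((delta ^ (K + k)) (degPart (smulFam (expandSub f) (oppFam YW v u w)) d))).Finite ∧
    expand ibinom ((delta ^ (K + k)) (degPart (smulFam (expandSub f) (oppFam YW v u w)) d)) =
      (shift ^ (K + k)) fun q => YWf YW (skewTerm A f v u q) w (-(d - q) - 1) := by
  obtain ⟨N, hN⟩ := hmod.prodDeg_eq_zero v u w
  obtain ⟨L, hL⟩ := exists_trunc YW u w
  have hL' : ∀ m < -L, ∀ t, oppFam YW v u w m t = 0 := fun m hm t => by
    rw [oppFam, hL _ (by omega), YWf_zero_right]
  have hN' : ∀ d < N, degPart (oppFam YW v u w) d = 0 := fun d hd => by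
    rw [degPart_oppFam, hN d hd]
    rfl
  have hfin (n : ℤ) : (Function.support
      ((delta ^ (n + K).toNat) ((delta ^ k) (degPart (oppFam YW v u w) (d - n))))).Finite := by
    rw [degPart_oppFam]
    exact finite_support_delta_pow (hmod.expand_reflect_prodDeg hk w (d - n)).1 _
  rw [delta_pow_degPart_smulFam hf hL' hN']
  constructor
  · refine ((Finset.Icc (-(K : ℤ)) (d - N)).finite_toSet.biUnion fun n _ => hfin n).subset ?_
    intro m hm
    rw [Function.mem_support, Finset.sum_apply] at hm
    obtain ⟨n, hn, hnm⟩ := Finset.exists_ne_zero_of_sum_ne_zero hm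
    exact Set.mem_biUnion hn (right_ne_zero_of_smul hnm)
  · rw [expand_sum _ _ _ fun n _ => Expandable.of_finite (hfin n)]
    funext a
    rw [Finset.sum_apply, shift_pow_apply, hmod.YWf_skewTerm hf hk hN]
    refine Finset.sum_congr rfl fun n hn => ?_
    obtain ⟨hfin', hexp⟩ := hmod.expand_reflect_prodDeg hk w (d - n)
    have hn0 := Finset.mem_Icc.1 hn
    rw [Pi.smul_apply, degPart_oppFam, expand_delta_pow isPascal_ibinom
      (Expandable.of_finite hfin'), hexp, shift_pow_apply, shift_pow_apply]
    have h1 : a - ((n + K).toNat : ℤ) - k = a - (K + k : ℕ) - n := by push_cast; omega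
    rw [h1, sub_sub_sub_cancel_right]

theorem IsModule.sLocPair_iff_modes (hmod : IsModule A YW) {u v : V} {r : ℕ} {f : Fin r → LC}
    {vi ui : Fin r → V} {K k : ℕ} (hf : ∀ i, ∀ n < -(K : ℤ), (f i).coeff n = 0)
    (hk : ∀ n ≥ (k : ℤ), Yf A u v n = 0) (hki : ∀ i, ∀ n ≥ (k : ℤ), Yf A (vi i) (ui i) n = 0) :
    sLocPair (YWf YW) (K + k) u v f vi ui ↔ ∀ w d q,
      YWf YW (Yf A u v (-q - 1)) w (-(d - q) - 1) =
        YWf YW (∑ i, skewTerm A (f i) (vi i) (ui i) q) w (-(d - q) - 1) := by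
  rw [sLocPair_iff]
  refine forall₂_congr fun w d => ?_
  obtain ⟨hfin, hexp⟩ := hmod.expand_prodDeg (k := K + k)
    (fun n hn => hk n (by push_cast at hn; omega)) w d
  have hR := fun i => hmod.expand_smulFam_oppFam (hf i) (hki i) w d
  set R : Fin r → ℤ → W := fun i =>
    (delta ^ (K + k)) (degPart (smulFam (expandSub (f i)) (oppFam YW (vi i) (ui i) w)) d)
  have hRfin : (Function.support (∑ i, R i)).Finite := by
    refine (Set.finite_iUnion fun i => (hR i).1).subset fun m hm => ?_
    rw [Function.mem_support, Finset.sum_apply] at hm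
    obtain ⟨i, -, hi⟩ := Finset.exists_ne_zero_of_sum_ne_zero hm
    exact Set.mem_iUnion.2 ⟨i, hi⟩
  have hRexp : expand ibinom (∑ i, R i) = (shift ^ (K + k)) fun q =>
      YWf YW (∑ i, skewTerm A (f i) (vi i) (ui i) q) w (-(d - q) - 1) := by
    have h1 := expand_sum (c := ibinom) Finset.univ R (fun _ => 1)
      fun i _ => Expandable.of_finite (hR i).1
    simp only [one_smul] at h1
    rw [h1, Finset.sum_congr rfl fun i _ => (hR i).2, ← map_sum]
    congr 1
    funext q
    rw [Finset.sum_apply, ← modeLin_apply, map_sum]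
    rfl
  have hinj : (delta ^ (K + k)) (prodDeg YW u v w d) = ∑ i, R i ↔
      expand ibinom ((delta ^ (K + k)) (prodDeg YW u v w d)) = expand ibinom (∑ i, R i) := by
    refine ⟨fun h => by rw [h], fun h => sub_eq_zero.1 (eq_zero_of_expand_ibinom ?_ ?_)⟩
    · exact (hfin.union hRfin).subset (Function.support_sub _ _)
    · rw [expand_sub (Expandable.of_finite hfin) (Expandable.of_finite hRfin), h, sub_self]
  rw [hinj, hexp, hRexp, (shift_pow_injective _).eq_iff, funext_iff]
  rfl

lemma exists_coeff_bound {r : ℕ} (f : Fin r → LC) :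
    ∃ K : ℕ, ∀ i, ∀ n < -(K : ℤ), (f i).coeff n = 0 := by
  obtain ⟨K, hK⟩ := (Set.finite_range fun i => (-(f i).order).toNat).bddAbove
  refine ⟨K, fun i n hn => HahnSeries.coeff_eq_zero_of_lt_order ?_⟩
  have : (-(f i).order).toNat ≤ K := hK (Set.mem_range_self i)
  omega

lemma exists_mode_bound (A : NLVA V) {r : ℕ} (vi ui : Fin r → V) :
    ∃ k : ℕ, ∀ i, ∀ n ≥ (k : ℤ), Yf A (vi i) (ui i) n = 0 := by
  choose b hb using fun i => exists_trunc A.Y (vi i) (ui i)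
  obtain ⟨k, hk⟩ := (Set.finite_range fun i => (b i).toNat).bddAbove
  refine ⟨k, fun i n hn => hb i n ?_⟩
  have : (b i).toNat ≤ k := hk (Set.mem_range_self i)
  omega

end Locality

/-- cf. Proposition 5.3 / `pskew-slocality`.  Let `V` be a
nonlocal vertex algebra, `(W, Y_W)` a `V`-module, `u, v, u⁽ⁱ⁾, v⁽ⁱ⁾ ∈ V`,
`fᵢ(x) ∈ ℂ((x))`.  If the `𝒮`-skew symmetry
`Y(u,x)v = ∑ᵢ fᵢ(-x) e^{x𝒟} Y(v⁽ⁱ⁾,-x) u⁽ⁱ⁾` holds (stated coefficientwise in `x`),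
then there is `k ∈ ℕ` with
`(x₁-x₂)^k Y_W(u,x₁)Y_W(v,x₂) = (x₁-x₂)^k ∑ᵢ fᵢ(x₂-x₁) Y_W(v⁽ⁱ⁾,x₂)Y_W(u⁽ⁱ⁾,x₁)`;
if `(W, Y_W)` is faithful, the converse also holds. -/
theorem statement14 {V W : Type*} [AddCommGroup V] [Module ℂ V]
    [AddCommGroup W] [Module ℂ W]
    (A : NLVA V) (YW : V →ₗ[ℂ] EW W) (hmod : IsModule A YW)
    {r : ℕ} (u v : V) (ui vi : Fin r → V) (f : Fin r → LC) :
    ((∀ k : ℤ, Yf A u v (-k - 1) =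
        ∑ i, ∑ᶠ n : ℤ, ((f i).coeff n * (-1 : ℂ) ^ n) • expDY A (vi i) (ui i) (k - n)) →
      ∃ k : ℕ, sLocPair (YWf YW) k u v f vi ui) ∧
    (Function.Injective YW →
      (∃ k : ℕ, sLocPair (YWf YW) k u v f vi ui) →
      (∀ k : ℤ, Yf A u v (-k - 1) =
        ∑ i, ∑ᶠ n : ℤ, ((f i).coeff n * (-1 : ℂ) ^ n) • expDY A (vi i) (ui i) (k - n))) := by
  obtain ⟨K, hK⟩ := exists_coeff_bound f
  obtain ⟨k₁, hk₁⟩ := exists_trunc A.Y u v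
  obtain ⟨k₂, hk₂⟩ := exists_mode_bound A vi ui
  have key (k : ℕ) := hmod.sLocPair_iff_modes (k := k₁.toNat + k₂ + k) hK
    (fun n hn => hk₁ n (by omega)) (fun i n hn => hk₂ i n (by omega))
  refine ⟨fun h => ⟨_, (key 0).2 fun w d q => ?_⟩, fun hinj ⟨k, hloc⟩ q => hinj ?_⟩
  · rw [h q]
    rfl
  · refine Subtype.ext (LinearMap.ext fun w => funext fun n => ?_)
    have h := (key k).1 (hloc.mono (by omega)) w (q - n - 1) q
    rwa [show -(q - n - 1 - q) - 1 = n by ring] at h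

end NVA
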